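/- arXiv:2011.00609 — 5 statements merged into one kernel-verified Lean document; each statement's English description precedes it below -/
import Mathlib

section
/- Let n ≥ 2 and let θ be a real number with |θ| < π/n. For every integer k with 1 ≤ k ≤ n−1 and each sign choice s ∈ {+1, −1}, the complex number μ_k^s = 2·sin(πk/n)·e^{−i(π/2 + πk/n + s·θ)} has strictly negative real part. Moreover μ_0^± = 0. -/
open Real

/-- The real part of `2 sin a · e^{-i(π/2 + a + φ)}` is `-2 sin a sin (a + φ)`. -/
theorem re_two_sin_mul_exp_neg_I_mul (a φ : ℝ) :
    (((2 * Real.sin a : ℝ) : ℂ) *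
      Complex.exp (-Complex.I * ((Real.pi / 2 + a + φ : ℝ) : ℂ))).re =
        -(2 * Real.sin a * Real.sin (a + φ)) := by
  have h : -Complex.I * ((Real.pi / 2 + a + φ : ℝ) : ℂ) =
      ((-(Real.pi / 2 + a + φ) : ℝ) : ℂ) * Complex.I := by
    push_cast
    ring
  rw [h, Complex.re_ofReal_mul, Complex.exp_ofReal_mul_I_re, Real.cos_neg,
    show Real.pi / 2 + a + φ = a + φ + Real.pi / 2 by ring, Real.cos_add_pi_div_two]
  ring

/-- For `n ≥ 2` and `|θ| < π/n`, every eigenvalue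
`μ_k^s = 2 sin(πk/n) e^{-i(π/2 + πk/n + sθ)}` of `M̂` with `1 ≤ k ≤ n-1` and
`s ∈ {+1, -1}` has strictly negative real part, and `μ_0^± = 0`. -/
theorem deviated_cyclic_pursuit_eigenvalues_neg_re
    (n : ℕ) (hn : 2 ≤ n) (θ : ℝ) (hθ : |θ| < Real.pi / n) :
    (∀ k : ℕ, 1 ≤ k → k ≤ n - 1 → ∀ s : ℝ, s = 1 ∨ s = -1 →
      (((2 * Real.sin (Real.pi * k / n) : ℝ) : ℂ) *
        Complex.exp (-Complex.I * ((Real.pi / 2 + Real.pi * k / n + s * θ : ℝ) : ℂ))).re < 0) ∧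
    (∀ s : ℝ, s = 1 ∨ s = -1 →
      (((2 * Real.sin (Real.pi * (0 : ℕ) / n) : ℝ) : ℂ) *
        Complex.exp (-Complex.I * ((Real.pi / 2 + Real.pi * (0 : ℕ) / n + s * θ : ℝ) : ℂ))) = 0) := by
  refine ⟨fun k hk hkn s hs => ?_, fun s _ => by simp⟩
  have hn0 : (0 : ℝ) < n := by
    exact_mod_cast (by lia : 0 < n)
  have hk1 : (1 : ℝ) ≤ k := by exact_mod_cast hk
  have hkn1 : (k : ℝ) + 1 ≤ n := by exact_mod_cast (by lia : k + 1 ≤ n)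
  have hlow : Real.pi / n ≤ Real.pi * k / n := by
    gcongr
    nlinarith [Real.pi_pos]
  have hupp : Real.pi * k / n + Real.pi / n ≤ Real.pi := by
    rw [← add_div, div_le_iff₀ hn0]
    nlinarith [Real.pi_pos]
  have hpos : 0 < Real.pi / n := div_pos Real.pi_pos hn0
  have hsθ : |s * θ| < Real.pi / n := by
    rcases hs with rfl | rfl <;> simpa using hθ
  obtain ⟨h₁, h₂⟩ := abs_lt.mp hsθ
  have hsin : 0 < Real.sin (Real.pi * k / n) :=
    Real.sin_pos_of_pos_of_lt_pi (by linarith) (by linarith)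
  have hsin' : 0 < Real.sin (Real.pi * k / n + s * θ) :=
    Real.sin_pos_of_pos_of_lt_pi (by linarith) (by linarith)
  rw [re_two_sin_mul_exp_neg_I_mul, neg_lt_zero]
  positivity
end

section
/- Let n ≥ 2, let v_1 ∈ ℂⁿ have l-th entry (1/√n)·e^{−2πil/n} (l = 0,…,n−1), let ζ_1⁻ = v_1 ⊗ (1, −i)ᵀ ∈ ℂ^{2n}, Y = ζ_1⁻(ζ_1⁻)*, and ω = 2·sin(π/n). Let x_l, y_l ∈ ℝ (l = 1,…,n) be initial coordinates and P(0) ∈ ℝ^{2n} their stacked vector. Set ρ_{kl} = 2π(k−l)/n, a_k = (1/n)∑_{l=1}^n (cos(ρ_{kl})·x_l + sin(ρ_{kl})·y_l), and b_k = (1/n)∑_{l=1}^n (−sin(ρ_{kl})·x_l + cos(ρ_{kl})·y_l). Then for every t ∈ ℝ and every k = 1,…,n, the k-th 2-block of the vector (cos(ωt)·Re(Y) + sin(ωt)·Im(Y))·P(0) equals (a_k·cos(ωt) + b_k·sin(ωt), −a_k·sin(ωt) + b_k·cos(ωt))ᵀ; in particular each agent moves on a circle of radius √(a_k² + b_k²)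 with angular velocity ω. -/
open scoped Matrix

/-- The discrete Fourier vector `v_1`, with `l`-th entry `(1/√n)·e^{-2πil/n}`. -/
noncomputable def fourierVec1 (n : ℕ) : Fin n → ℂ :=
  fun l => ((1 / Real.sqrt n : ℝ) : ℂ) *
    Complex.exp (-2 * (Real.pi : ℂ) * Complex.I * (l : ℕ) / n)

/-- `ζ_1⁻ = v_1 ⊗ (1, -i)ᵀ ∈ ℂ^{2n}`. -/
noncomputable def zeta1M (n : ℕ) : Fin n × Fin 2 → ℂ :=
  fun p => fourierVec1 n p.1 * (if p.2 = 0 then 1 else -Complex.I)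

/-- The outer product `v_1 v_1*` has entries `(1/n)·e^{-iρ}` with `ρ = 2π(k-l)/n`. -/
theorem fourierVec1_mul_star (n : ℕ) (k l : Fin n) :
    fourierVec1 n k * star (fourierVec1 n l) =
      ((1 / n : ℝ) : ℂ) *
        Complex.exp (((-(2 * Real.pi * (((k : ℕ) : ℤ) - ((l : ℕ) : ℤ)) / n) : ℝ) : ℂ) *
          Complex.I) := by
  have h : ((1 / Real.sqrt n : ℝ) : ℂ) * ((1 / Real.sqrt n : ℝ) : ℂ) = ((1 / n : ℝ) : ℂ) := by
    rw [← Complex.ofReal_mul, div_mul_div_comm, Real.mul_self_sqrt n.cast_nonneg, one_mul]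
  simp only [fourierVec1, Complex.star_def, map_mul, Complex.conj_ofReal, ← Complex.exp_conj]
  rw [mul_mul_mul_comm, h, ← Complex.exp_add]
  congr 2
  simp only [map_div₀, map_mul, map_neg, Complex.conj_I, Complex.conj_ofReal, map_natCast,
    map_ofNat]
  push_cast
  ring

theorem fourierVec1_mul_star_re (n : ℕ) (k l : Fin n) :
    (fourierVec1 n k * star (fourierVec1 n l)).re =
      1 / n * Real.cos (2 * Real.pi * (((k : ℕ) : ℤ) - ((l : ℕ) : ℤ)) / n) := by
  rw [fourierVec1_mul_star, Complex.re_ofReal_mul, Complex.exp_ofReal_mul_I_re, Real.cos_neg]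

theorem fourierVec1_mul_star_im (n : ℕ) (k l : Fin n) :
    (fourierVec1 n k * star (fourierVec1 n l)).im =
      -(1 / n * Real.sin (2 * Real.pi * (((k : ℕ) : ℤ) - ((l : ℕ) : ℤ)) / n)) := by
  rw [fourierVec1_mul_star, Complex.im_ofReal_mul, Complex.exp_ofReal_mul_I_im, Real.sin_neg,
    mul_neg]

/-- The entries of `ζ_1⁻(ζ_1⁻)*` in terms of those of `v_1 v_1*`. -/
theorem vecMulVec_zeta1M (n : ℕ) (p q : Fin n × Fin 2) :
    Matrix.vecMulVec (zeta1M n) (star (zeta1M n)) p q =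
      fourierVec1 n p.1 * star (fourierVec1 n q.1) *
        ((if p.2 = 0 then 1 else -Complex.I) * (if q.2 = 0 then 1 else Complex.I)) := by
  rw [Matrix.vecMulVec_apply, Pi.star_apply, zeta1M, zeta1M, star_mul', mul_mul_mul_comm]
  split_ifs <;> simp

/-- At the critical deviation angle, with `Y = ζ_1⁻(ζ_1⁻)*`,
`ω = 2 sin(π/n)`, `ρ_{kl} = 2π(k-l)/n`,
`a_k = (1/n)∑_l (cos ρ_{kl}·x_l + sin ρ_{kl}·y_l)` and
`b_k = (1/n)∑_l (-sin ρ_{kl}·x_l + cos ρ_{kl}·y_l)`, the `k`-th 2-block of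
`(cos(ωt)·Re Y + sin(ωt)·Im Y)·P(0)` equals
`(a_k cos(ωt) + b_k sin(ωt), -a_k sin(ωt) + b_k cos(ωt))ᵀ`:
each agent moves on a circle of radius `√(a_k² + b_k²)` with angular velocity `ω`. -/
theorem critical_angle_circular_motion (n : ℕ) (hn : 2 ≤ n)
    (x y : Fin n → ℝ) (t : ℝ) (k : Fin n) :
    letI Y := Matrix.vecMulVec (zeta1M n) (star (zeta1M n))
    letI ω : ℝ := 2 * Real.sin (Real.pi / n)
    letI P₀ : Fin n × Fin 2 → ℝ := fun p => if p.2 = 0 then x p.1 else y p.1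
    letI ρ : Fin n → Fin n → ℝ := fun k l =>
      2 * Real.pi * (((k : ℕ) : ℤ) - ((l : ℕ) : ℤ)) / n
    letI a : Fin n → ℝ := fun k =>
      (1 / n) * ∑ l : Fin n, (Real.cos (ρ k l) * x l + Real.sin (ρ k l) * y l)
    letI b : Fin n → ℝ := fun k =>
      (1 / n) * ∑ l : Fin n, (-Real.sin (ρ k l) * x l + Real.cos (ρ k l) * y l)
    letI A : Matrix (Fin n × Fin 2) (Fin n × Fin 2) ℝ :=
      Matrix.of fun p q =>
        Real.cos (ω * t) * (Y p q).re + Real.sin (ω * t) * (Y p q).im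
    A.mulVec P₀ (k, 0) = a k * Real.cos (ω * t) + b k * Real.sin (ω * t) ∧
    A.mulVec P₀ (k, 1) = -(a k) * Real.sin (ω * t) + b k * Real.cos (ω * t) := by
  constructor <;>
  · simp only [Matrix.mulVec, dotProduct, Fintype.sum_prod_type, Fin.sum_univ_two, Matrix.of_apply,
      vecMulVec_zeta1M, Finset.mul_sum, Finset.sum_mul, ← Finset.sum_add_distrib,
      ← Finset.sum_neg_distrib]
    refine Finset.sum_congr rfl fun l _ => ?_
    simp only [Complex.mul_re (_ * _), Complex.mul_im (_ * _), fourierVec1_mul_star_re,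
      fourierVec1_mul_star_im]
    simp
    ring
end

section
/- Let n ≥ 1, let B ∈ {0,1}ⁿ with n_l = #{l : B_l = 1}, let U_c ∈ ℝ², and let ζ_0^± = (1/√n)·(1, ±i, 1, ±i, …, 1, ±i) ∈ ℂ^{2n}. Then every 2-block of the vector (1/2)·(ζ_0⁺(ζ_0⁺)* + ζ_0⁻(ζ_0⁻)*)·(B ⊗ I₂)·U_c equals (n_l/n)·U_c. (This is the common asymptotic velocity of all agents: each agent moves with velocity (n_l/n)·U_c.) -/
open scoped Matrix

/-- `ζ_0⁺ = (1/√n)·(1, i, 1, i, …, 1, i) ∈ ℂ^{2n}`. -/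
noncomputable def zeta0P (n : ℕ) : Fin n × Fin 2 → ℂ :=
  fun p => ((1 / Real.sqrt n : ℝ) : ℂ) * (if p.2 = 0 then 1 else Complex.I)

/-- `ζ_0⁻ = (1/√n)·(1, -i, 1, -i, …, 1, -i) ∈ ℂ^{2n}`. -/
noncomputable def zeta0M (n : ℕ) : Fin n × Fin 2 → ℂ :=
  fun p => ((1 / Real.sqrt n : ℝ) : ℂ) * (if p.2 = 0 then 1 else -Complex.I)

/-- The average of the orthogonal projections onto `ζ_0⁺` and `ζ_0⁻` is `(1/n)·(𝟙𝟙ᵀ ⊗ I₂)`. -/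
theorem half_smul_zeta0_projections_apply (n : ℕ) (p q : Fin n × Fin 2) :
    (((1 : ℂ) / 2) • (Matrix.vecMulVec (zeta0P n) (star (zeta0P n)) +
        Matrix.vecMulVec (zeta0M n) (star (zeta0M n)))) p q =
      if p.2 = q.2 then (n : ℂ)⁻¹ else 0 := by
  have hsq : ((1 / Real.sqrt n : ℝ) : ℂ) * ((1 / Real.sqrt n : ℝ) : ℂ) = (n : ℂ)⁻¹ := by
    rw [← Complex.ofReal_mul, div_mul_div_comm, Real.mul_self_sqrt n.cast_nonneg]
    simp
  obtain ⟨k, j⟩ := p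
  obtain ⟨l, m⟩ := q
  simp only [Matrix.smul_apply, Matrix.add_apply, Matrix.vecMulVec_apply, Pi.star_apply,
    zeta0P, zeta0M, star_mul', Complex.star_def, Complex.conj_ofReal, smul_eq_mul, ← hsq]
  generalize ((1 / Real.sqrt n : ℝ) : ℂ) = c
  fin_cases j <;> fin_cases m <;> simp <;> ring_nf <;> simp

/-- The entries of a 0/1 vector sum to its number of ones. -/
theorem sum_eq_card_filter_eq_one {ι : Type*} [Fintype ι] (B : ι → ℝ)
    (hB : ∀ l, B l = 0 ∨ B l = 1) :
    ∑ l, B l = ((Finset.univ.filter fun l => B l = 1).card : ℝ) := by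
  rw [← Finset.sum_boole]
  refine Finset.sum_congr rfl fun l _ => ?_
  rcases hB l with h | h <;> simp [h]

/-- For a 0/1 leaders-indicator vector `B` with `n_l` ones and a
broadcast velocity `U_c ∈ ℝ²`, every 2-block of
`(1/2)·(ζ_0⁺(ζ_0⁺)* + ζ_0⁻(ζ_0⁻)*)·(B ⊗ I₂)·U_c` equals `(n_l/n)·U_c`:
the common asymptotic velocity of all agents. -/
theorem common_asymptotic_velocity (n : ℕ) (hn : 1 ≤ n)
    (B : Fin n → ℝ) (hB : ∀ l, B l = 0 ∨ B l = 1)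
    (nl : ℕ) (hnl : nl = (Finset.univ.filter fun l => B l = 1).card)
    (Uc : Fin 2 → ℝ) (k : Fin n) (j : Fin 2) :
    (((1 : ℂ) / 2) • (Matrix.vecMulVec (zeta0P n) (star (zeta0P n)) +
        Matrix.vecMulVec (zeta0M n) (star (zeta0M n)))).mulVec
          (fun p => ((B p.1 : ℝ) : ℂ) * ((Uc p.2 : ℝ) : ℂ)) (k, j) =
      ((nl : ℂ) / (n : ℂ)) * ((Uc j : ℝ) : ℂ) := by
  have hsum : ∑ l, (B l : ℂ) = nl := by
    rw [hnl, ← Complex.ofReal_sum, sum_eq_card_filter_eq_one B hB, Complex.ofReal_natCast]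
  simp only [Matrix.mulVec, dotProduct, half_smul_zeta0_projections_apply, ite_mul, zero_mul,
    Fintype.sum_prod_type, Finset.sum_ite_eq, Finset.mem_univ, if_true]
  rw [← Finset.mul_sum, ← Finset.sum_mul, hsum]
  ring
end

section
/- Let n ≥ 2, θ ∈ ℝ, and 1 ≤ k ≤ n−1. With λ_k = −1 + e^{−2πik/n} (which is nonzero), μ_k^± = λ_k·e^{±iθ}, v_k ∈ ℂⁿ the vector with l-th entry (1/√n)·e^{−2πikl/n}, and ζ_k^± = v_k ⊗ (1, ±i)ᵀ, the following 2n×2n complex matrix identity holds: (1/μ_k⁺)·ζ_k⁺(ζ_k⁺)* + (1/μ_k⁻)·ζ_k⁻(ζ_k⁻)* = (2/λ_k)·(v_k v_k*) ⊗ R(−θ), where R(−θ) = [[cos θ, −sin θ], [sin θ, cos θ]] is viewed with complex entries. -/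
open scoped Matrix Kronecker

/-- The discrete Fourier vector `v_k`, with `l`-th entry `(1/√n)·e^{-2πikl/n}`. -/
noncomputable def fourierVec (n k : ℕ) : Fin n → ℂ :=
  fun l => ((1 / Real.sqrt n : ℝ) : ℂ) *
    Complex.exp (-2 * (Real.pi : ℂ) * Complex.I * k * l / n)

/-- The eigenvalue `λ_k = -1 + e^{-2πik/n}` of the cyclic-pursuit matrix. -/
noncomputable def lamk (n k : ℕ) : ℂ :=
  -1 + Complex.exp (-2 * (Real.pi : ℂ) * Complex.I * k / n)

/-- `ζ_k⁺ = v_k ⊗ (1, i)ᵀ`. -/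
noncomputable def zetaP (n k : ℕ) : Fin n × Fin 2 → ℂ :=
  fun p => fourierVec n k p.1 * (if p.2 = 0 then 1 else Complex.I)

/-- `ζ_k⁻ = v_k ⊗ (1, -i)ᵀ`. -/
noncomputable def zetaM (n k : ℕ) : Fin n × Fin 2 → ℂ :=
  fun p => fourierVec n k p.1 * (if p.2 = 0 then 1 else -Complex.I)

/-- `R(-θ) = [[cos θ, -sin θ], [sin θ, cos θ]]`, viewed with complex entries. -/
noncomputable def rotNegC (θ : ℝ) : Matrix (Fin 2) (Fin 2) ℂ :=
  !![((Real.cos θ : ℝ) : ℂ), ((-Real.sin θ : ℝ) : ℂ);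
     ((Real.sin θ : ℝ) : ℂ), ((Real.cos θ : ℝ) : ℂ)]

theorem lamk_ne_zero {n k : ℕ} (hk0 : 0 < k) (hkn : k < n) : lamk n k ≠ 0 := by
  intro h
  have hexp : Complex.exp (-2 * (Real.pi : ℂ) * Complex.I * k / n) = 1 := by
    unfold lamk at h
    linear_combination h
  obtain ⟨m, hm⟩ := Complex.exp_eq_one_iff.mp hexp
  have hn : (n : ℂ) ≠ 0 := Nat.cast_ne_zero.mpr (by omega)
  rw [div_eq_iff hn] at hm
  have hkm : (k : ℂ) = -m * n := by
    apply mul_left_cancel₀ Complex.two_pi_I_ne_zero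
    linear_combination -hm
  have hdvd : (n : ℤ) ∣ k := ⟨-m, by rw [mul_comm]; exact_mod_cast hkm⟩
  exact absurd (Nat.le_of_dvd hk0 (Int.natCast_dvd_natCast.mp hdvd)) (by omega)

/-- For `1 ≤ k ≤ n-1` the eigenvalue `λ_k` is nonzero and,
with `μ_k^± = λ_k·e^{±iθ}`, the matrix identity
`(1/μ_k⁺)·ζ_k⁺(ζ_k⁺)* + (1/μ_k⁻)·ζ_k⁻(ζ_k⁻)* = (2/λ_k)·(v_k v_k*) ⊗ R(-θ)` holds. -/
theorem rank_one_pair_combines_to_rotation (n : ℕ) (hn : 2 ≤ n) (θ : ℝ)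
    (k : ℕ) (hk1 : 1 ≤ k) (hk : k ≤ n - 1) :
    lamk n k ≠ 0 ∧
    (lamk n k * Complex.exp (Complex.I * (θ : ℂ)))⁻¹ •
        Matrix.vecMulVec (zetaP n k) (star (zetaP n k)) +
      (lamk n k * Complex.exp (-(Complex.I * (θ : ℂ))))⁻¹ •
        Matrix.vecMulVec (zetaM n k) (star (zetaM n k)) =
      ((2 : ℂ) / lamk n k) •
        (Matrix.vecMulVec (fourierVec n k) (star (fourierVec n k)) ⊗ₖ rotNegC θ) := by
  refine ⟨lamk_ne_zero (by omega) (by omega), ?_⟩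
  have hcos := Complex.cos_add_sin_I (θ : ℂ)
  have hcos' := Complex.cos_sub_sin_I (θ : ℂ)
  ext ⟨a, i⟩ ⟨b, j⟩
  rw [mul_comm Complex.I (θ : ℂ), mul_inv, mul_inv, ← Complex.exp_neg, ← Complex.exp_neg,
    neg_neg, ← neg_mul, ← hcos, ← hcos']
  fin_cases i <;> fin_cases j <;>
    simp [Matrix.vecMulVec_apply, zetaP, zetaM, rotNegC, div_eq_mul_inv] <;>
    grind [Complex.I_mul_I]
end

section
/- Let n ≥ 2, θ ∈ ℝ, B ∈ ℂⁿ, U_c ∈ ℂ². With λ_k = −1 + e^{−2πik/n}, μ_k^± = λ_k·e^{±iθ}, v_k the vector with l-th entry (1/√n)·e^{−2πikl/n}, ζ_k^± = v_k ⊗ (1, ±i)ᵀ, M the n×n cyclic-pursuit matrix (M_{ii} = −1, M_{i,i+1 mod n} = 1, other entries 0), and γ = ∑_{k=1}^{n−1} (1/(λ_k·conj(λ_k)))·v_k v_k*, the following holds: (1/2)·∑_{k=1}^{n−1}[(1/μ_k⁺)·ζ_k⁺(ζ_k⁺)* + (1/μ_k⁻)·ζ_k⁻(ζ_k⁻)*]·(B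 ⊗ I₂)·U_c = (γ·Mᵀ·B) ⊗ (R(−θ)·U_c). Consequently, writing σ = γ·Mᵀ·B, the i-th 2-block of this deviation vector equals σ_i·R(−θ)·U_c, so the agents asymptotically align along the direction R(−θ)U_c; and if B = 𝟙_n then Mᵀ·B = 0 and the whole deviation vector vanishes. -/
open scoped Matrix

/-- The `n × n` cyclic-pursuit matrix `M = circ(-1, 1, 0, …, 0)` (complex entries). -/
noncomputable def cyclicM (n : ℕ) : Matrix (Fin n) (Fin n) ℂ :=
  Matrix.of fun i j =>
    if j.val = i.val then -1 else if j.val = (i.val + 1) % n then 1 else 0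

/-- Away from the degenerate size one, `M` is the cyclic shift minus the identity. -/
theorem cyclicM_apply_eq (m : ℕ) (i j : Fin (m + 2)) :
    cyclicM (m + 2) i j = (if j = i then -1 else 0) + (if j = i + 1 then 1 else 0) := by
  have hv : (i + 1).val = (i.val + 1) % (m + 2) := by simp [Fin.val_add]
  have hne : i ≠ i + 1 := by simp
  simp only [cyclicM, Matrix.of_apply, ← hv, ← Fin.ext_iff]
  by_cases h : j = i
  · subst h; simp
  · simp [h]

/-- The discrete Fourier vector is an eigenvector of the cyclic shift. -/
theorem fourierVec_add_one (m k : ℕ) (i : Fin (m + 2)) :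
    fourierVec (m + 2) k (i + 1) =
      Complex.exp (-2 * (Real.pi : ℂ) * Complex.I * k / (m + 2 : ℕ)) *
        fourierVec (m + 2) k i := by
  have hv : (i + 1).val = (i.val + 1) % (m + 2) := by simp [Fin.val_add]
  have hn : ((m + 2 : ℕ) : ℂ) ≠ 0 := by exact_mod_cast (by omega : m + 2 ≠ 0)
  simp only [fourierVec]
  rw [mul_left_comm, ← Complex.exp_add]
  congr 1
  rw [Complex.exp_eq_exp_iff_exists_int]
  rcases Nat.lt_or_ge (i.val + 1) (m + 2) with h | h
  · refine ⟨0, ?_⟩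
    rw [hv, Nat.mod_eq_of_lt h]
    push_cast
    ring
  · have hi : i.val + 1 = m + 2 := by omega
    refine ⟨k, ?_⟩
    have hi' : (i.val : ℂ) = ((m + 2 : ℕ) : ℂ) - 1 := by
      rw [eq_sub_iff_add_eq]; exact_mod_cast hi
    rw [hv, hi, Nat.mod_self, hi']
    field_simp
    push_cast
    ring

theorem cyclicM_mulVec_fourierVec (m k : ℕ) :
    (cyclicM (m + 2)).mulVec (fourierVec (m + 2) k) =
      lamk (m + 2) k • fourierVec (m + 2) k := by
  ext i
  simp only [Matrix.mulVec, dotProduct, cyclicM_apply_eq, add_mul, ite_mul, zero_mul,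
    Finset.sum_add_distrib, Finset.sum_ite_eq', Finset.mem_univ, if_true, fourierVec_add_one,
    lamk, Pi.smul_apply, smul_eq_mul]
  ring

theorem cyclicM_transpose_mulVec_one (m : ℕ) :
    (cyclicM (m + 2))ᵀ.mulVec (fun _ => 1) = 0 := by
  ext j
  have h (i : Fin (m + 2)) : j = i + 1 ↔ j - 1 = i := sub_eq_iff_eq_add.symm
  simp [Matrix.mulVec, dotProduct, cyclicM_apply_eq, Finset.sum_add_distrib, h]

theorem star_cyclicM_apply (n : ℕ) (i j : Fin n) :
    star (cyclicM n i j) = cyclicM n i j := by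
  simp only [cyclicM, Matrix.of_apply]
  split_ifs <;> simp

theorem star_fourierVec_dotProduct_transpose (m k : ℕ) (B : Fin (m + 2) → ℂ) :
    star (fourierVec (m + 2) k) ⬝ᵥ (cyclicM (m + 2))ᵀ.mulVec B =
      star (lamk (m + 2) k) * (star (fourierVec (m + 2) k) ⬝ᵥ B) := by
  have hM : (cyclicM (m + 2))ᵀ = (cyclicM (m + 2))ᴴ := by
    ext i j
    simp only [Matrix.transpose_apply, Matrix.conjTranspose_apply, star_cyclicM_apply]
  rw [Matrix.dotProduct_mulVec, hM, ← Matrix.star_mulVec, cyclicM_mulVec_fourierVec, star_smul,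
    smul_dotProduct, smul_eq_mul]

theorem star_zetaP_dotProduct (n k : ℕ) (B : Fin n → ℂ) (U : Fin 2 → ℂ) :
    star (zetaP n k) ⬝ᵥ (fun p => B p.1 * U p.2) =
      (star (fourierVec n k) ⬝ᵥ B) * (U 0 - Complex.I * U 1) := by
  simp only [dotProduct, Fintype.sum_prod_type, Fin.sum_univ_two, zetaP, Pi.star_apply,
    Finset.sum_mul]
  refine Finset.sum_congr rfl fun i _ => ?_
  simp
  ring

theorem star_zetaM_dotProduct (n k : ℕ) (B : Fin n → ℂ) (U : Fin 2 → ℂ) :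
    star (zetaM n k) ⬝ᵥ (fun p => B p.1 * U p.2) =
      (star (fourierVec n k) ⬝ᵥ B) * (U 0 + Complex.I * U 1) := by
  simp only [dotProduct, Fintype.sum_prod_type, Fin.sum_univ_two, zetaM, Pi.star_apply,
    Finset.sum_mul]
  refine Finset.sum_congr rfl fun i _ => ?_
  simp
  ring

/-- The conjugate pair of planar projectors, weighted by `e^{∓iθ}`, averages to `R(-θ)`. -/
theorem rotNegC_mulVec_eq (θ : ℝ) (U : Fin 2 → ℂ) (a : Fin 2) :
    (rotNegC θ).mulVec U a =
      1 / 2 * (Complex.exp (-(Complex.I * θ)) * (U 0 - Complex.I * U 1) *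
          (if a = 0 then 1 else Complex.I) +
        Complex.exp (Complex.I * θ) * (U 0 + Complex.I * U 1) *
          (if a = 0 then 1 else -Complex.I)) := by
  have h₁ : Complex.exp (Complex.I * θ) = Complex.cos θ + Complex.sin θ * Complex.I := by
    rw [mul_comm, Complex.exp_mul_I]
  have h₂ : Complex.exp (-(Complex.I * θ)) = Complex.cos θ - Complex.sin θ * Complex.I := by
    rw [mul_comm, ← neg_mul, Complex.exp_mul_I, Complex.cos_neg, Complex.sin_neg]
    ring
  rw [h₁, h₂]
  fin_cases a
  · simp [rotNegC, Matrix.mulVec, dotProduct, Fin.sum_univ_two]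
    linear_combination (-Complex.sin θ * U 1) * Complex.I_sq
  · simp [rotNegC, Matrix.mulVec, dotProduct, Fin.sum_univ_two]
    linear_combination (Complex.sin θ * U 0 + Complex.cos θ * U 1) * Complex.I_sq

theorem inv_mul_star_mul_star (z : ℂ) : (z * (starRingEnd ℂ) z)⁻¹ * star z = z⁻¹ := by
  rcases eq_or_ne z 0 with rfl | hz
  · simp
  · have h : (starRingEnd ℂ) z ≠ 0 := (map_ne_zero _).2 hz
    rw [← starRingEnd_apply]
    field_simp

/-- The asymptotic deviation vector
`(1/2)·∑_{k=1}^{n-1}[(1/μ_k⁺)ζ_k⁺(ζ_k⁺)* + (1/μ_k⁻)ζ_k⁻(ζ_k⁻)*]·(B ⊗ I₂)·U_c`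
equals `(γ·Mᵀ·B) ⊗ (R(-θ)·U_c)` where `γ = ∑_{k=1}^{n-1} (1/(λ_k·conj λ_k))·v_k v_k*`;
hence with `σ = γ·Mᵀ·B` the `i`-th 2-block is `σ_i·R(-θ)·U_c`, and if `B = 𝟙_n`
then `Mᵀ·B = 0` and the whole deviation vector vanishes. -/
theorem deviation_vector_rotated_alignment (n : ℕ) (hn : 2 ≤ n) (θ : ℝ)
    (B : Fin n → ℂ) (Uc : Fin 2 → ℂ) :
    letI Δ : Fin n × Fin 2 → ℂ :=
      (((1 : ℂ) / 2) • ∑ k ∈ Finset.Icc 1 (n - 1),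
        ((lamk n k * Complex.exp (Complex.I * (θ : ℂ)))⁻¹ •
            Matrix.vecMulVec (zetaP n k) (star (zetaP n k)) +
          (lamk n k * Complex.exp (-(Complex.I * (θ : ℂ))))⁻¹ •
            Matrix.vecMulVec (zetaM n k) (star (zetaM n k)))).mulVec
        (fun p => B p.1 * Uc p.2)
    letI γ : Matrix (Fin n) (Fin n) ℂ :=
      ∑ k ∈ Finset.Icc 1 (n - 1),
        (lamk n k * (starRingEnd ℂ) (lamk n k))⁻¹ •
          Matrix.vecMulVec (fourierVec n k) (star (fourierVec n k))
    letI σ : Fin n → ℂ := γ.mulVec ((cyclicM n)ᵀ.mulVec B)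
    (∀ p : Fin n × Fin 2, Δ p = σ p.1 * (rotNegC θ).mulVec Uc p.2) ∧
    ((B = fun _ => 1) → (cyclicM n)ᵀ.mulVec B = 0 ∧ Δ = 0) := by
  obtain ⟨m, rfl⟩ : ∃ m, n = m + 2 := ⟨n - 2, by omega⟩
  refine (and_iff_left_of_imp fun h hB => ?_).2 fun p => ?_
  · have hM : (cyclicM (m + 2))ᵀ.mulVec B = 0 := hB ▸ cyclicM_transpose_mulVec_one m
    refine ⟨hM, funext fun p => ?_⟩
    rw [h p, hM]
    simp
  · simp only [Matrix.smul_mulVec, Matrix.sum_mulVec, Matrix.add_mulVec,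
      Matrix.vecMulVec_mulVec, star_zetaP_dotProduct, star_zetaM_dotProduct,
      star_fourierVec_dotProduct_transpose, Pi.smul_apply, Finset.sum_apply, Pi.add_apply,
      smul_eq_mul, MulOpposite.smul_eq_mul_unop, MulOpposite.unop_op, rotNegC_mulVec_eq,
      Finset.mul_sum, Finset.sum_mul]
    refine Finset.sum_congr rfl fun k _ => ?_
    rw [mul_left_comm _ (fourierVec _ _ _), ← mul_assoc (_⁻¹) (star _),
      inv_mul_star_mul_star, mul_inv, mul_inv, ← Complex.exp_neg, ← Complex.exp_neg, neg_neg]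
    simp only [zetaP, zetaM]
    ring
end
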